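/- Let A be a biflat Banach algebra and φ ∈ Δ(A). Then A is approximately left φ-biprojective. -/

import Mathlib

open Filter Topology

universe u

/-! ## Nets indexed by directed sets -/

/-- A (nonempty) directed index type, used to index nets. -/
structure DirSys : Type (u + 1) where
  ι : Type u
  [pre : Preorder ι]
  [dir : IsDirected ι (· ≤ ·)]
  [ne : Nonempty ι]

attribute [instance] DirSys.pre DirSys.dir DirSys.ne

section Core

variable (A : Type u) [NonUnitalNormedRing A] [NormedSpace ℂ A]
  [IsScalarTower ℂ A A] [SMulCommClass ℂ A A]

/-- A realization of the projective tensor product `A ⊗̂ A` of a Banach algebra `A` with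
itself, together with its canonical Banach `A`-bimodule structure and the product
(diagonal) map `π_A`.  The field `universal` is the universal property of the projective
tensor norm, which pins the object down uniquely up to isometric isomorphism. -/
structure ProjTensorSq (X : Type u) [NormedAddCommGroup X] [NormedSpace ℂ X]
    [CompleteSpace X] : Type (u + 1) where
  /-- the canonical bilinear map `(a, b) ↦ a ⊗ b` -/
  tmul : A →L[ℂ] A →L[ℂ] X
  /-- the projective norm is a cross norm -/
  norm_tmul : ∀ a b : A, ‖tmul a b‖ = ‖a‖ * ‖b‖
  /-- elementary tensors span a dense subspace -/
  dense_span : Dense (Submodule.span ℂ (Set.range fun p : A × A => tmul p.1 p.2) : Set X)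
  /-- the universal property of the projective tensor product -/
  universal : ∀ (Y : Type u) [NormedAddCommGroup Y] [NormedSpace ℂ Y] [CompleteSpace Y]
      (f : A →L[ℂ] A →L[ℂ] Y), ∃ g : X →L[ℂ] Y, ‖g‖ ≤ ‖f‖ ∧ ∀ a b : A, g (tmul a b) = f a b
  /-- the left module action `a · (b ⊗ c) = (a * b) ⊗ c` -/
  lsmul : A →L[ℂ] X →L[ℂ] X
  lsmul_tmul : ∀ a b c : A, lsmul a (tmul b c) = tmul (a * b) c
  /-- the right module action `(b ⊗ c) · a = b ⊗ (c * a)` -/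
  rsmul : A →L[ℂ] X →L[ℂ] X
  rsmul_tmul : ∀ a b c : A, rsmul a (tmul b c) = tmul b (c * a)
  /-- the product map `π_A`, determined by `π_A (a ⊗ b) = a * b` -/
  projL : X →L[ℂ] A
  projL_tmul : ∀ a b : A, projL (tmul a b) = a * b

variable {A}

/-- `A` is approximately left `φ`-biprojective:  there is a net `(ρ_α)` of bounded linear
maps `A → A ⊗̂ A` with `a·ρ_α(x) - ρ_α(ax) → 0`, `ρ_α(xa) - φ(a)ρ_α(x) → 0` and
`φ(π_A(ρ_α(x))) → φ(x)` for all `a x : A`. -/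
def ApproxLeftBiprojective (φ : WeakDual.characterSpace ℂ A) : Prop :=
  ∀ (X : Type u) [NormedAddCommGroup X] [NormedSpace ℂ X] [CompleteSpace X]
    (P : ProjTensorSq A X),
    ∃ (D : DirSys.{u}) (ρ : D.ι → (A →L[ℂ] X)),
      (∀ a x : A, Tendsto (fun i => P.lsmul a (ρ i x) - ρ i (a * x)) atTop (𝓝 0)) ∧
      (∀ a x : A, Tendsto (fun i => ρ i (x * a) - φ a • ρ i x) atTop (𝓝 0)) ∧
      (∀ x : A, Tendsto (fun i => φ (P.projL (ρ i x))) atTop (𝓝 (φ x)))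

/-- `A` is approximately left character biprojective if it is approximately left
`φ`-biprojective for every character `φ` of `A`. -/
def ApproxLeftCharBiprojective : Prop :=
  ∀ φ : WeakDual.characterSpace ℂ A, ApproxLeftBiprojective φ

/-- `A` is approximately left `φ`-amenable: there is a (not necessarily bounded) net
`(a_α)` in `A` with `‖a * a_α - φ(a) a_α‖ → 0` for every `a` and `φ(a_α) → 1`. -/
def ApproxLeftAmenable (φ : WeakDual.characterSpace ℂ A) : Prop :=
  ∃ (D : DirSys.{u}) (v : D.ι → A),
    (∀ a : A, Tendsto (fun i => a * v i - φ a • v i) atTop (𝓝 0)) ∧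
    Tendsto (fun i => φ (v i)) atTop (𝓝 1)

/-- `A` is approximately biprojective (Zhang): there is a net `(ρ_α)` of bounded
`A`-bimodule morphisms `A → A ⊗̂ A` with `π_A(ρ_α(a)) → a` for every `a`. -/
def ApproxBiprojective : Prop :=
  ∀ (X : Type u) [NormedAddCommGroup X] [NormedSpace ℂ X] [CompleteSpace X]
    (P : ProjTensorSq A X),
    ∃ (D : DirSys.{u}) (ρ : D.ι → (A →L[ℂ] X)),
      (∀ i, ∀ a b : A, ρ i (a * b) = P.lsmul a (ρ i b)) ∧
      (∀ i, ∀ a b : A, ρ i (a * b) = P.rsmul b (ρ i a)) ∧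
      (∀ a : A, Tendsto (fun i => P.projL (ρ i a)) atTop (𝓝 a))

/-- `A` is pseudo-amenable: there is a (not necessarily bounded) net `(m_α)` in `A ⊗̂ A`
with `a·m_α - m_α·a → 0` and `π_A(m_α) a → a` for every `a`. -/
def PseudoAmenable : Prop :=
  ∀ (X : Type u) [NormedAddCommGroup X] [NormedSpace ℂ X] [CompleteSpace X]
    (P : ProjTensorSq A X),
    ∃ (D : DirSys.{u}) (m : D.ι → X),
      (∀ a : A, Tendsto (fun i => P.lsmul a (m i) - P.rsmul a (m i)) atTop (𝓝 0)) ∧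
      (∀ a : A, Tendsto (fun i => P.projL (m i) * a - a) atTop (𝓝 0))

end Core

section Biflat

variable {A : Type u} [NonUnitalNormedRing A] [NormedSpace ℂ A]
  [IsScalarTower ℂ A A] [SMulCommClass ℂ A A]

/-- The operator on the dual space induced by precomposition with a bounded operator. -/
noncomputable def dualOp {X : Type u} [NormedAddCommGroup X] [NormedSpace ℂ X]
    (T : X →L[ℂ] X) : (X →L[ℂ] ℂ) →L[ℂ] (X →L[ℂ] ℂ) :=
  (ContinuousLinearMap.compL ℂ X X ℂ).flip T

/-- `A` is biflat: there is a bounded `A`-bimodule morphism `ρ : A → (A ⊗̂ A)**`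
(the bidual carrying the canonical bimodule structure) such that `π_A** ∘ ρ` is the
canonical embedding of `A` into `A**`, i.e. `ρ a (f ∘ π_A) = f a` for every bounded
functional `f` on `A`. -/
def Biflat : Prop :=
  ∀ (X : Type u) [NormedAddCommGroup X] [NormedSpace ℂ X] [CompleteSpace X]
    (P : ProjTensorSq A X),
    ∃ ρ : A →L[ℂ] ((X →L[ℂ] ℂ) →L[ℂ] ℂ),
      (∀ a b : A, ρ (a * b) = (ρ b).comp (dualOp (P.lsmul a))) ∧
      (∀ a b : A, ρ (a * b) = (ρ a).comp (dualOp (P.rsmul b))) ∧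
      (∀ (a : A) (f : A →L[ℂ] ℂ), ρ a (f.comp P.projL) = f a)

end Biflat

/-- If `y` is not in the closure of the range of `L`, then Hahn–Banach separates it; hence `y`
lies in that closure as soon as some functional `m` on the dual space is compatible with it. -/
theorem mem_closure_range_of_bidual {E F : Type*} [NormedAddCommGroup E] [NormedSpace ℂ E]
    [NormedAddCommGroup F] [NormedSpace ℂ F] (L : E →L[ℂ] F) (y : F)
    (m : (E →L[ℂ] ℂ) →L[ℂ] ℂ) (h : ∀ f : F →L[ℂ] ℂ, m (f.comp L) = f y) :
    y ∈ closure (Set.range L) := by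
  by_contra hy
  let S : Submodule ℂ F := (LinearMap.range (L : E →ₗ[ℂ] F)).topologicalClosure
  have hyS : y ∉ S := by
    rw [← SetLike.mem_coe, Submodule.topologicalClosure_coe]
    exact hy
  have : IsClosed (S : Set F) := Submodule.isClosed_topologicalClosure _
  have hne : S.mkQL y ≠ 0 := by
    simpa using hyS
  obtain ⟨f, hf⟩ := SeparatingDual.exists_ne_zero (R := ℂ) hne
  have hL : (f.comp S.mkQL).comp L = 0 := by
    ext v
    have : S.mkQL (L v) = 0 := by
      simpa using Submodule.le_topologicalClosure _ (LinearMap.mem_range_self (L : E →ₗ[ℂ] F) v)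
    rw [ContinuousLinearMap.comp_apply, ContinuousLinearMap.comp_apply, this, map_zero,
      zero_apply]
  have := h (f.comp S.mkQL)
  rw [hL, map_zero] at this
  exact hf this.symm

section

variable {A : Type u} [NonUnitalNormedRing A] [NormedSpace ℂ A]

namespace ProjTensorSq

variable {X : Type u} [NormedAddCommGroup X] [NormedSpace ℂ X] [CompleteSpace X]
  (P : ProjTensorSq A X)

theorem clm_ext {Y : Type*} [NormedAddCommGroup Y] [NormedSpace ℂ Y] {f g : X →L[ℂ] Y}
    (h : ∀ a b, f (P.tmul a b) = g (P.tmul a b)) : f = g :=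
  ContinuousLinearMap.ext_on P.dense_span (by rintro _ ⟨p, rfl⟩; exact h p.1 p.2)

/-- The slice map `id ⊗ φ : A ⊗̂ A → A`. -/
theorem exists_slice [CompleteSpace A] (φ : A →L[ℂ] ℂ) :
    ∃ g : X →L[ℂ] A, ∀ a b, g (P.tmul a b) = φ b • a := by
  obtain ⟨g, -, hg⟩ := P.universal A (ContinuousLinearMap.smulRightL ℂ A A φ)
  exact ⟨g, fun a b => by simp [hg]⟩

end ProjTensorSq

variable [IsScalarTower ℂ A A] [SMulCommClass ℂ A A]

/-- Slicing the splitting morphism of a biflat algebra by a character `φ` gives a functional `m`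
on `A*` with `x · a · m = φ a • x · m` and `m φ = 1`. -/
theorem Biflat.exists_bidual [CompleteSpace A] (hbf : Biflat (A := A))
    {X : Type u} [NormedAddCommGroup X] [NormedSpace ℂ X] [CompleteSpace X]
    (P : ProjTensorSq A X) (φ : A →L[ℂ] ℂ) (hφ : ∀ a b, φ (a * b) = φ a * φ b) {x₀ : A}
    (hx₀ : φ x₀ = 1) :
    ∃ m : (A →L[ℂ] ℂ) →L[ℂ] ℂ,
      (∀ (x a : A) (f : A →L[ℂ] ℂ), m (f.comp (ContinuousLinearMap.mul ℂ A (x * a))) =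
        φ a * m (f.comp (ContinuousLinearMap.mul ℂ A x))) ∧ m φ = 1 := by
  obtain ⟨ρ, hl, hr, hπ⟩ := hbf X P
  obtain ⟨g, hg⟩ := P.exists_slice φ
  have left (a : A) : (ContinuousLinearMap.mul ℂ A a).comp g = g.comp (P.lsmul a) :=
    P.clm_ext fun b c => by simp [hg, P.lsmul_tmul]
  have right (a : A) : g.comp (P.rsmul a) = φ a • g :=
    P.clm_ext fun b c => by simp [hg, P.rsmul_tmul, hφ, smul_smul, mul_comm]
  have proj : φ.comp g = φ.comp P.projL :=
    P.clm_ext fun b c => by simp [hg, P.projL_tmul, hφ, mul_comm]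
  have mul_left (a b : A) (f : A →L[ℂ] ℂ) :
      ρ b ((f.comp (ContinuousLinearMap.mul ℂ A a)).comp g) = ρ (a * b) (f.comp g) := by
    rw [hl, ContinuousLinearMap.comp_assoc, left]
    rfl
  have mul_right (a b : A) (f : A →L[ℂ] ℂ) :
      ρ (a * b) (f.comp g) = φ b * ρ a (f.comp g) := by
    have : dualOp (P.rsmul b) (f.comp g) = φ b • f.comp g := by
      change (f.comp g).comp (P.rsmul b) = _
      rw [ContinuousLinearMap.comp_assoc, right, ContinuousLinearMap.comp_smul]
    rw [hr, ContinuousLinearMap.comp_apply, this, map_smul, smul_eq_mul]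
  refine ⟨(ρ x₀).comp ((ContinuousLinearMap.compL ℂ X A ℂ).flip g), fun x a f => ?_, ?_⟩
  · change ρ x₀ ((f.comp _).comp g) = φ a * ρ x₀ ((f.comp _).comp g)
    rw [mul_left, mul_left, mul_right, mul_right, mul_right x, hx₀]
    ring
  · change ρ x₀ (φ.comp g) = 1
    rw [proj, hπ, hx₀]

/-- A functional `m` as in `Biflat.exists_bidual` is approximated, on finitely many conditions at
a time, by elements of `A`. -/
theorem exists_approx_of_bidual (φ : A →L[ℂ] ℂ) (m : (A →L[ℂ] ℂ) →L[ℂ] ℂ)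
    (hm : ∀ (x a : A) (f : A →L[ℂ] ℂ), m (f.comp (ContinuousLinearMap.mul ℂ A (x * a))) =
      φ a * m (f.comp (ContinuousLinearMap.mul ℂ A x))) (hmφ : m φ = 1)
    (s : Finset (A × A)) {ε : ℝ} (hε : 0 < ε) :
    ∃ v : A, (∀ p ∈ s, ‖p.1 * p.2 * v - φ p.2 • (p.1 * v)‖ < ε) ∧ ‖φ v - 1‖ < ε := by
  let D (p : A × A) : A →L[ℂ] A :=
    ContinuousLinearMap.mul ℂ A (p.1 * p.2) - φ p.2 • ContinuousLinearMap.mul ℂ A p.1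
  let L : A →L[ℂ] (s → A) × ℂ := (ContinuousLinearMap.pi fun p : s => D p).prod φ
  have hD (p : A × A) (f : A →L[ℂ] ℂ) : m (f.comp (D p)) = 0 := by
    simp only [D, ContinuousLinearMap.comp_sub, ContinuousLinearMap.comp_smul, map_sub, map_smul,
      hm, smul_eq_mul, sub_self]
  have hmem : ((0, 1) : (s → A) × ℂ) ∈ closure (Set.range L) := by
    classical
    refine mem_closure_range_of_bidual L _ m fun f => ?_
    have hf : f.comp L =
        ∑ p : s, ((f.comp (.inl ℂ _ _)).comp (.single ℂ (fun _ : s => A) p)).comp (D p)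
          + f (0, 1) • φ := by
      ext v
      have h₁ : L v = (∑ p : s, Pi.single p (D p v), 0) + φ v • ((0, 1) : (s → A) × ℂ) := by
        rw [Finset.univ_sum_single fun p : s => D p v]
        simp [L]
      have h₂ : f (∑ p : s, Pi.single p (D p v), 0) = ∑ p : s, f (Pi.single p (D p v), 0) :=
        map_sum (f.comp (.inl ℂ (s → A) ℂ)) _ _
      rw [ContinuousLinearMap.comp_apply, h₁, map_add, h₂, map_smul]
      simp [mul_comm]
    rw [hf, map_add, map_sum, map_smul, hmφ]
    simp [hD]
  obtain ⟨_, ⟨v, rfl⟩, hv⟩ := Metric.mem_closure_iff.1 hmem ε hε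
  rw [dist_comm, dist_eq_norm, Prod.norm_def, max_lt_iff] at hv
  refine ⟨v, fun p hp => ?_, by simpa [L] using hv.2⟩
  have := (pi_norm_lt_iff hε).1 hv.1 ⟨p, hp⟩
  simpa [L, D] using this

end

/-- Corollary 2.7.  Every biflat Banach algebra `A` with a character
`φ ∈ Δ(A)` is approximately left `φ`-biprojective. -/
theorem biflat_implies_approxLeftBiprojective
    {A : Type u} [NonUnitalNormedRing A] [NormedSpace ℂ A]
    [IsScalarTower ℂ A A] [SMulCommClass ℂ A A] [CompleteSpace A]
    (φ : WeakDual.characterSpace ℂ A)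
    (hbf : Biflat (A := A)) :
    ApproxLeftBiprojective φ := by
  classical
  intro X _ _ _ P
  let ψ : A →L[ℂ] ℂ := WeakDual.CharacterSpace.toCLM φ
  obtain ⟨x₀, hx₀⟩ : ∃ x, φ x = 1 := by
    obtain ⟨x, hx⟩ : ∃ x, φ x ≠ 0 := by
      by_contra! h
      exact φ.2.1 (ContinuousLinearMap.ext h)
    exact ⟨(φ x)⁻¹ • x, by simp [hx]⟩
  obtain ⟨m, hm, hmφ⟩ := hbf.exists_bidual P ψ (map_mul φ) hx₀
  choose v hv hvφ using fun i : Finset (A × A) × ℕ =>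
    exists_approx_of_bidual ψ m hm hmφ i.1 (ε := 1 / ((i.2 : ℝ) + 1)) Nat.one_div_pos_of_nat
  have hlim : Tendsto (fun i : Finset (A × A) × ℕ => 1 / ((i.2 : ℝ) + 1)) atTop (𝓝 0) := by
    rw [← prod_atTop_atTop_eq]
    exact tendsto_one_div_add_atTop_nhds_zero_nat.comp tendsto_snd
  have hv_lim (x a : A) : Tendsto (fun i => x * a * v i - φ a • (x * v i)) atTop (𝓝 0) := by
    refine squeeze_zero_norm' ?_ hlim
    filter_upwards [eventually_ge_atTop (({(x, a)}, 0) : Finset (A × A) × ℕ)] with i hi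
    exact (hv i (x, a) (hi.1 (Finset.mem_singleton_self _))).le
  have hvφ_lim : Tendsto (fun i => φ (v i)) atTop (𝓝 1) :=
    tendsto_iff_norm_sub_tendsto_zero.2
      (squeeze_zero (fun _ => norm_nonneg _) (fun i => (hvφ i).le) hlim)
  refine ⟨⟨Finset (A × A) × ℕ⟩,
    fun i => (P.tmul.flip x₀).comp ((ContinuousLinearMap.mul ℂ A).flip (v i)), ?_, ?_, ?_⟩
  · intro a x
    simp [P.lsmul_tmul, mul_assoc]
  · intro a x
    have := ((P.tmul.flip x₀).continuous.tendsto 0).comp (hv_lim x a)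
    simpa [Function.comp_def] using this
  · intro x
    simpa [P.projL_tmul, hx₀] using hvφ_lim.const_mul (φ x)
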